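/- The function ξ ↦ λ₀(ξ) is continuous on (0,+∞) and bounded; in particular Λ := sup_{ξ∈(0,+∞)} λ₀(ξ) satisfies 0 < Λ < +∞. -/

import Mathlib

open Real MeasureTheory Set

noncomputable section

/-- The function `r ↦ r W(r)`. -/
def rW (W : ℝ → ℝ) : ℝ → ℝ := fun r => r * W r

/-- The functional `E₁(ξ,W) = ∫_I [ξ² r ρ̄ W² + r ρ̄ |D(rW)|²] dr`. -/
def E1fun (R₁ R₂ : ℝ) (ρ : ℝ → ℝ) (ξ : ℝ) (W : ℝ → ℝ) : ℝ :=
  ∫ r in R₁..R₂, (ξ ^ 2 * r * ρ r * (W r) ^ 2 + r * ρ r * (deriv (rW W) r) ^ 2)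

/-- The functional `E₂(ξ,W)`. -/
def E2fun (R₁ R₂ μ α : ℝ) (ξ : ℝ) (W : ℝ → ℝ) : ℝ :=
  (∫ r in R₁..R₂,
    (r * (2 * ξ ^ 2 + 1) * (deriv W r) ^ 2 + ((ξ ^ 2 - 1) ^ 2 / r) * (W r) ^ 2 +
      r * (deriv (deriv (rW W)) r) ^ 2)) +
  (1 - α / μ * R₁) * (deriv (rW W) R₁) ^ 2

/-- The functional `E₃(ξ,W) = −ξ² ∫_I g r W² Dρ̄ dr`. -/
def E3fun (R₁ R₂ g : ℝ) (ρ : ℝ → ℝ) (ξ : ℝ) (W : ℝ → ℝ) : ℝ :=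
  -(ξ ^ 2) * ∫ r in R₁..R₂, g * r * (W r) ^ 2 * deriv ρ r

/-- The functional `E(s,ξ,W) = μ s E₂(ξ,W) + E₃(ξ,W)`. -/
def Efun (R₁ R₂ μ α g : ℝ) (ρ : ℝ → ℝ) (s ξ : ℝ) (W : ℝ → ℝ) : ℝ :=
  μ * s * E2fun R₁ R₂ μ α ξ W + E3fun R₁ R₂ g ρ ξ W

/-- Admissible profile: `W ∈ C²`, `W(R₁) = W(R₂) = 0` and `DW(R₂) = 0`. -/
def AdmW (R₁ R₂ : ℝ) (W : ℝ → ℝ) : Prop :=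
  ContDiff ℝ 2 W ∧ W R₁ = 0 ∧ W R₂ = 0 ∧ deriv W R₂ = 0

/-- The set of values `E(s,ξ,W)/E₁(ξ,W)` over admissible, not identically zero, `W`. -/
def PhiSet (R₁ R₂ μ α g : ℝ) (ρ : ℝ → ℝ) (s ξ : ℝ) : Set ℝ :=
  {x : ℝ | ∃ W : ℝ → ℝ, AdmW R₁ R₂ W ∧ (∃ r ∈ Icc R₁ R₂, W r ≠ 0) ∧
    x = Efun R₁ R₂ μ α g ρ s ξ W / E1fun R₁ R₂ ρ ξ W}

/-- `Φ(s,ξ) = inf { E(s,ξ,W)/E₁(ξ,W) : W admissible, W ≢ 0 }`. -/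
def Phi (R₁ R₂ μ α g : ℝ) (ρ : ℝ → ℝ) (s ξ : ℝ) : ℝ :=
  sInf (PhiSet R₁ R₂ μ α g ρ s ξ)

/-- `λ_c(ξ) = sup { −E₃(ξ,W) : W admissible, μ E₂(ξ,W) = 1 }`. -/
def lamc (R₁ R₂ μ α g : ℝ) (ρ : ℝ → ℝ) (ξ : ℝ) : ℝ :=
  sSup {x : ℝ | ∃ W : ℝ → ℝ, AdmW R₁ R₂ W ∧ μ * E2fun R₁ R₂ μ α ξ W = 1 ∧
    x = -E3fun R₁ R₂ g ρ ξ W}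

open Topology in
/-- Let `l ξ` be a root in `s` of the infimum over `i` of the quadratic functionals below, which are
increasing in `s`. If `d` is controlled by `a`, then `l` is continuous. -/
lemma continuousOn_critical_growth {ι : Type*} {a b c d e h : ι → ℝ} {K μ : ℝ} (hμ : 0 < μ)
    (ha : ∀ i, 0 ≤ a i) (hb : ∀ i, 0 ≤ b i) (hc : ∀ i, 0 ≤ c i)
    (he : ∀ i, 0 ≤ e i) (hd : ∀ i, 0 ≤ d i) (hda : ∀ i, d i ≤ K * a i) {F : ℝ → ℝ → ι → ℝ}
    (hF : ∀ s ξ i, F s ξ i = s ^ 2 * (ξ ^ 2 * a i + b i) +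
      μ * s * ((2 * ξ ^ 2 + 1) * c i + (ξ ^ 2 - 1) ^ 2 * d i + e i) - ξ ^ 2 * h i)
    {l : ℝ → ℝ} (hl : ∀ ξ, 0 < ξ → 0 < l ξ) (hnonneg : ∀ ξ, 0 < ξ → ∀ i, 0 ≤ F (l ξ) ξ i)
    (hneg : ∀ ξ, 0 < ξ → ∀ s, 0 < s → s < l ξ → ∃ i, F s ξ i < 0) :
    ContinuousOn l (Ioi 0) := by
  have hmono : ∀ s t ξ i, 0 < s → s ≤ t → F s ξ i ≤ F t ξ i := by
    intro s t ξ i hs hst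
    have := ha i; have := hb i; have := hc i; have := hd i; have := he i
    rw [hF, hF]
    gcongr
  intro ξ₀ hξ₀
  have hξ₀ : 0 < ξ₀ := hξ₀
  have hpos : ∀ᶠ ξ in 𝓝 ξ₀, 0 < ξ := lt_mem_nhds hξ₀
  apply ContinuousAt.continuousWithinAt
  refine tendsto_order.2 ⟨fun s hs => ?_, fun t ht => ?_⟩
  · rcases le_or_gt s 0 with hs0 | hs0
    · filter_upwards [hpos] with ξ hξ
      exact hs0.trans_lt (hl ξ hξ)
    obtain ⟨i, hi⟩ := hneg ξ₀ hξ₀ s hs0 hs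
    have hcont : Continuous fun ξ => F s ξ i := by
      simp only [hF]
      fun_prop
    filter_upwards [hpos, hcont.continuousAt.eventually_lt_const hi] with ξ hξ hneg'
    by_contra! hle
    exact absurd (hnonneg ξ hξ i) (not_le.2 ((hmono _ _ _ _ (hl ξ hξ) hle).trans_lt hneg'))
  · obtain ⟨s, hls, hst⟩ := exists_between ht
    have hl₀ := hl ξ₀ hξ₀
    have hs0 : 0 < s := hl₀.trans hls
    have hsq : l ξ₀ ^ 2 < s ^ 2 := by gcongr
    have hq : ξ₀ ^ 2 / ξ₀ ^ 2 = 1 := div_self (by positivity)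
    have key (f : ℝ → ℝ) (hf : Continuous f) (h0 : 0 < f ξ₀) : ∀ᶠ ξ in 𝓝 ξ₀, 0 < f ξ :=
      hf.continuousAt.eventually_const_lt h0
    have hA := key (fun ξ => ξ ^ 2 * (s ^ 2 - l ξ₀ ^ 2) + μ * K * min 0
        (s * (ξ ^ 2 - 1) ^ 2 - l ξ₀ * (ξ₀ ^ 2 - 1) ^ 2 * (ξ ^ 2 / ξ₀ ^ 2))) (by fun_prop) (by
      have : 0 ≤ s * (ξ₀ ^ 2 - 1) ^ 2 - l ξ₀ * (ξ₀ ^ 2 - 1) ^ 2 := by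
        rw [← sub_mul]
        exact mul_nonneg (sub_nonneg.2 hls.le) (sq_nonneg _)
      rw [hq, mul_one, min_eq_left this, mul_zero, add_zero]
      exact mul_pos (by positivity) (sub_pos.2 hsq))
    have hB := key (fun ξ => s ^ 2 - l ξ₀ ^ 2 * (ξ ^ 2 / ξ₀ ^ 2)) (by fun_prop) (by
      rw [hq]; linarith)
    have hC := key (fun ξ => s * (2 * ξ ^ 2 + 1) - l ξ₀ * (2 * ξ₀ ^ 2 + 1) * (ξ ^ 2 / ξ₀ ^ 2))
      (by fun_prop) (by
        rw [hq, mul_one, ← sub_mul]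
        exact mul_pos (sub_pos.2 hls) (by positivity))
    have hE := key (fun ξ => s - l ξ₀ * (ξ ^ 2 / ξ₀ ^ 2)) (by fun_prop) (by
      rw [hq]; linarith)
    filter_upwards [hpos, hA, hB, hC, hE] with ξ hξ hA hB hC hE
    refine lt_of_le_of_lt ?_ hst
    by_contra! hlt
    obtain ⟨i, hi⟩ := hneg ξ hξ s hs0 hlt
    refine absurd hi (not_lt.2 ?_)
    have h₀ := hnonneg ξ₀ hξ₀ i
    rw [hF] at h₀ ⊢
    set q := ξ ^ 2 / ξ₀ ^ 2 with hqdef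
    have hqξ : ξ ^ 2 = q * ξ₀ ^ 2 := by rw [hqdef]; field_simp
    set m := s * (ξ ^ 2 - 1) ^ 2 - l ξ₀ * (ξ₀ ^ 2 - 1) ^ 2 * q with hm
    have hmd : min 0 m * (K * a i) ≤ m * d i :=
      (mul_le_mul_of_nonpos_left (hda i) (min_le_left _ _)).trans
        (mul_le_mul_of_nonneg_right (min_le_right _ _) (hd i))
    have hμmd := mul_le_mul_of_nonneg_left hmd hμ.le
    have h₁ := mul_nonneg (show 0 ≤ q by positivity) h₀
    have h₂ := mul_nonneg hA.le (ha i)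
    have h₃ := mul_nonneg hB.le (hb i)
    have h₄ := mul_nonneg hμ.le (mul_nonneg hC.le (hc i))
    have h₅ := mul_nonneg hμ.le (mul_nonneg hE.le (he i))
    have hid : s ^ 2 * (ξ ^ 2 * a i + b i) +
        μ * s * ((2 * ξ ^ 2 + 1) * c i + (ξ ^ 2 - 1) ^ 2 * d i + e i) - ξ ^ 2 * h i =
        q * (l ξ₀ ^ 2 * (ξ₀ ^ 2 * a i + b i) + μ * l ξ₀ * ((2 * ξ₀ ^ 2 + 1) * c i +
          (ξ₀ ^ 2 - 1) ^ 2 * d i + e i) - ξ₀ ^ 2 * h i) +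
        ξ ^ 2 * (s ^ 2 - l ξ₀ ^ 2) * a i + (s ^ 2 - l ξ₀ ^ 2 * q) * b i +
        μ * ((s * (2 * ξ ^ 2 + 1) - l ξ₀ * (2 * ξ₀ ^ 2 + 1) * q) * c i) + μ * (m * d i) +
        μ * ((s - l ξ₀ * q) * e i) := by
      rw [hm]
      linear_combination (l ξ₀ ^ 2 * a i - h i) * hqξ
    rw [hid]
    linarith

lemma AdmW.contDiff_rW {R₁ R₂ : ℝ} {W : ℝ → ℝ} (hW : AdmW R₁ R₂ W) : ContDiff ℝ 2 (rW W) :=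
  contDiff_id.mul hW.1

lemma AdmW.continuous_deriv_deriv_rW {R₁ R₂ : ℝ} {W : ℝ → ℝ} (hW : AdmW R₁ R₂ W) :
    Continuous (deriv (deriv (rW W))) :=
  ContDiff.continuous_deriv (n := 1)
    (((contDiff_succ_iff_deriv (n := 1)).1 hW.contDiff_rW).2.2) le_rfl

lemma intervalIntegrable_of_continuousOn_Icc {a b : ℝ} (hab : a ≤ b) {f : ℝ → ℝ}
    (hf : ContinuousOn f (Icc a b)) : IntervalIntegrable f volume a b :=
  ContinuousOn.intervalIntegrable (by rwa [uIcc_of_le hab])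

lemma E1fun_eq {R₁ R₂ : ℝ} {ρ : ℝ → ℝ} (hρ : Continuous ρ) {W : ℝ → ℝ} (hW : AdmW R₁ R₂ W)
    (ξ : ℝ) :
    E1fun R₁ R₂ ρ ξ W = ξ ^ 2 * (∫ r in R₁..R₂, r * ρ r * (W r) ^ 2) +
      ∫ r in R₁..R₂, r * ρ r * (deriv (rW W) r) ^ 2 := by
  have h₁ := hW.1.continuous
  have h₂ := hW.contDiff_rW.continuous_deriv (by norm_num)
  rw [E1fun, intervalIntegral.integral_add, ← intervalIntegral.integral_const_mul]
  · simp only [mul_assoc]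
  all_goals exact Continuous.intervalIntegrable (by fun_prop) _ _

lemma E2fun_eq {R₁ R₂ : ℝ} (hR₁ : 0 < R₁) (hR₁₂ : R₁ < R₂) (μ α : ℝ) {W : ℝ → ℝ}
    (hW : AdmW R₁ R₂ W) (ξ : ℝ) :
    E2fun R₁ R₂ μ α ξ W = (2 * ξ ^ 2 + 1) * (∫ r in R₁..R₂, r * (deriv W r) ^ 2) +
      (ξ ^ 2 - 1) ^ 2 * (∫ r in R₁..R₂, (W r) ^ 2 / r) +
      ((∫ r in R₁..R₂, r * (deriv (deriv (rW W)) r) ^ 2) +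
        (1 - α / μ * R₁) * (deriv (rW W) R₁) ^ 2) := by
  have h₁ := hW.1.continuous
  have h₂ := hW.1.continuous_deriv (by norm_num)
  have h₃ := hW.continuous_deriv_deriv_rW
  have hd : IntervalIntegrable (fun r => (W r) ^ 2 / r) volume R₁ R₂ :=
    intervalIntegrable_of_continuousOn_Icc hR₁₂.le
      ((h₁.pow 2).continuousOn.div continuousOn_id fun r hr => (hR₁.trans_le hr.1).ne')
  have hc : IntervalIntegrable (fun r => r * (deriv W r) ^ 2) volume R₁ R₂ :=
    Continuous.intervalIntegrable (by fun_prop) _ _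
  have he : IntervalIntegrable (fun r => r * (deriv (deriv (rW W)) r) ^ 2) volume R₁ R₂ :=
    Continuous.intervalIntegrable (by fun_prop) _ _
  rw [E2fun, ← add_assoc, ← intervalIntegral.integral_const_mul,
    ← intervalIntegral.integral_const_mul,
    ← intervalIntegral.integral_add (hc.const_mul _) (hd.const_mul _),
    ← intervalIntegral.integral_add ((hc.const_mul _).add (hd.const_mul _)) he]
  congr 2
  ext r
  ring

theorem statement14 (R₁ R₂ μ α g : ℝ) (hR₁ : 0 < R₁) (hR₁₂ : R₁ < R₂) (hμ : 0 < μ)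
    (hg : 0 < g) (hα : 0 ≤ 1 - α * R₁ / μ) (ρ : ℝ → ℝ) (hρ : ContDiff ℝ (⊤ : ℕ∞) ρ)
    (hρpos : ∀ r ∈ Icc R₁ R₂, 0 < ρ r)
    (hinst : ∃ rs ∈ Ioo R₁ R₂, 0 < deriv ρ rs)
    (lam0 : ℝ → ℝ)
    (hlam0 : ∀ ξ : ℝ, 0 < ξ →
      lam0 ξ ∈ Ioo 0 (lamc R₁ R₂ μ α g ρ ξ) ∧
        (lam0 ξ) ^ 2 + Phi R₁ R₂ μ α g ρ (lam0 ξ) ξ = 0) :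
    ContinuousOn lam0 (Ioi 0) ∧ BddAbove (lam0 '' Ioi 0) ∧
      0 < sSup (lam0 '' Ioi 0) := by
  have hρc : Continuous ρ := hρ.continuous
  have hρ'c : Continuous (deriv ρ) := hρ.continuous_deriv (by simp)
  have hrpos : ∀ r ∈ Icc R₁ R₂, 0 < r := fun r hr => hR₁.trans_le hr.1
  have hα' : 0 ≤ 1 - α / μ * R₁ := by rwa [div_mul_eq_mul_div]
  obtain ⟨K, hK⟩ := isCompact_Icc.exists_bound_of_continuousOn
    (f := fun r => (r ^ 2 * ρ r)⁻¹) (s := Icc R₁ R₂) (by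
      refine ContinuousOn.inv₀ (by fun_prop) fun r hr => ?_
      have := hrpos r hr; have := hρpos r hr
      positivity)
  obtain ⟨M, hM⟩ := isCompact_Icc.exists_bound_of_continuousOn
    (f := fun r => g * deriv ρ r / ρ r) (s := Icc R₁ R₂)
    (ContinuousOn.div (by fun_prop) (by fun_prop) fun r hr => (hρpos r hr).ne')
  have hM0 : 0 ≤ M := (norm_nonneg _).trans (hM R₁ (left_mem_Icc.2 hR₁₂.le))
  let ι := {W : ℝ → ℝ // AdmW R₁ R₂ W ∧ ∃ r ∈ Icc R₁ R₂, W r ≠ 0}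
  let a : ι → ℝ := fun W => ∫ r in R₁..R₂, r * ρ r * (W.1 r) ^ 2
  let b : ι → ℝ := fun W => ∫ r in R₁..R₂, r * ρ r * (deriv (rW W.1) r) ^ 2
  let c : ι → ℝ := fun W => ∫ r in R₁..R₂, r * (deriv W.1 r) ^ 2
  let d : ι → ℝ := fun W => ∫ r in R₁..R₂, (W.1 r) ^ 2 / r
  let e : ι → ℝ := fun W => (∫ r in R₁..R₂, r * (deriv (deriv (rW W.1)) r) ^ 2) +
    (1 - α / μ * R₁) * (deriv (rW W.1) R₁) ^ 2
  let h : ι → ℝ := fun W => ∫ r in R₁..R₂, g * r * (W.1 r) ^ 2 * deriv ρ r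
  have ha : ∀ i, 0 < a i := by
    rintro ⟨W, hW, r₀, hr₀, hne⟩
    have hWc := hW.1.continuous
    simp only [a]
    refine intervalIntegral.integral_pos hR₁₂ (by fun_prop) (fun r hr => ?_) ⟨r₀, hr₀, ?_⟩
    · have hr := Ioc_subset_Icc_self hr
      have := hrpos r hr; have := hρpos r hr
      positivity
    · have := hrpos r₀ hr₀; have := hρpos r₀ hr₀
      positivity
  have hb : ∀ i, 0 ≤ b i := fun i => intervalIntegral.integral_nonneg hR₁₂.le fun r hr => by
    have := hrpos r hr; have := hρpos r hr
    positivity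
  have hc : ∀ i, 0 ≤ c i := fun i => intervalIntegral.integral_nonneg hR₁₂.le fun r hr => by
    have := hrpos r hr
    positivity
  have hd : ∀ i, 0 ≤ d i := fun i => intervalIntegral.integral_nonneg hR₁₂.le fun r hr => by
    have := hrpos r hr
    positivity
  have he : ∀ i, 0 ≤ e i := fun i => add_nonneg
    (intervalIntegral.integral_nonneg hR₁₂.le fun r hr => by
      have := hrpos r hr
      positivity) (by positivity)
  have hda : ∀ i, d i ≤ K * a i := by
    rintro ⟨W, hW, -⟩
    have hWc := hW.1.continuous
    simp only [a, d]
    rw [← intervalIntegral.integral_const_mul]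
    refine intervalIntegral.integral_mono_on hR₁₂.le
      (intervalIntegrable_of_continuousOn_Icc hR₁₂.le
        (ContinuousOn.div (by fun_prop) continuousOn_id fun r hr => (hrpos r hr).ne'))
      (Continuous.intervalIntegrable (by fun_prop) _ _) fun r hr => ?_
    have hr0 := hrpos r hr
    have hρ0 := hρpos r hr
    calc W r ^ 2 / r = (r ^ 2 * ρ r)⁻¹ * (r * ρ r * W r ^ 2) := by field_simp
      _ ≤ K * (r * ρ r * W r ^ 2) := by
        gcongr
        exact (le_abs_self _).trans (hK r hr)
  have hha : ∀ i, h i ≤ M * a i := by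
    rintro ⟨W, hW, -⟩
    have hWc := hW.1.continuous
    simp only [a, h]
    rw [← intervalIntegral.integral_const_mul]
    refine intervalIntegral.integral_mono_on hR₁₂.le
      (Continuous.intervalIntegrable (by fun_prop) _ _)
      (Continuous.intervalIntegrable (by fun_prop) _ _) fun r hr => ?_
    have hr0 := hrpos r hr
    have hρ0 := hρpos r hr
    calc g * r * W r ^ 2 * deriv ρ r = g * deriv ρ r / ρ r * (r * ρ r * W r ^ 2) := by field_simp
      _ ≤ M * (r * ρ r * W r ^ 2) := by
        gcongr
        exact (le_abs_self _).trans (hM r hr)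
  have hE1 : ∀ ξ (i : ι), E1fun R₁ R₂ ρ ξ i.1 = ξ ^ 2 * a i + b i :=
    fun ξ i => E1fun_eq hρc i.2.1 ξ
  have hE : ∀ s ξ (i : ι), Efun R₁ R₂ μ α g ρ s ξ i.1 =
      μ * s * ((2 * ξ ^ 2 + 1) * c i + (ξ ^ 2 - 1) ^ 2 * d i + e i) - ξ ^ 2 * h i := by
    intro s ξ i
    rw [Efun, E2fun_eq hR₁ hR₁₂ μ α i.2.1 ξ, E3fun]
    ring
  have hE1pos : ∀ ξ, 0 < ξ → ∀ i : ι, 0 < E1fun R₁ R₂ ρ ξ i.1 := by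
    intro ξ hξ i
    have := ha i; have := hb i
    rw [hE1]
    positivity
  have hlower : ∀ s ξ, 0 < s → 0 < ξ → ∀ x ∈ PhiSet R₁ R₂ μ α g ρ s ξ, -M ≤ x := by
    rintro s ξ hs hξ x ⟨W, hW, hW0, rfl⟩
    let i : ι := ⟨W, hW, hW0⟩
    rw [le_div_iff₀ (hE1pos ξ hξ i), hE1 ξ i, hE s ξ i]
    have := hb i; have := hc i; have := hd i; have := he i
    have h₁ : 0 ≤ μ * s * ((2 * ξ ^ 2 + 1) * c i + (ξ ^ 2 - 1) ^ 2 * d i + e i) := by positivity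
    have h₂ := mul_le_mul_of_nonneg_left (hha i) (sq_nonneg ξ)
    have h₃ : 0 ≤ M * b i := by positivity
    linarith
  have hpos : ∀ ξ, 0 < ξ → 0 < lam0 ξ := fun ξ hξ => (hlam0 ξ hξ).1.1
  have hPhi : ∀ ξ, 0 < ξ → Phi R₁ R₂ μ α g ρ (lam0 ξ) ξ = -(lam0 ξ) ^ 2 := fun ξ hξ => by
    linarith [(hlam0 ξ hξ).2]
  have hbdd : BddAbove (lam0 '' Ioi 0) := by
    refine ⟨√M, ?_⟩
    rintro _ ⟨ξ, hξ, rfl⟩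
    refine Real.le_sqrt_of_sq_le ?_
    have := Real.le_sInf (hlower _ ξ (hpos ξ hξ) hξ) (neg_nonpos.2 hM0)
    have hΦ := hPhi ξ hξ
    rw [Phi] at hΦ
    linarith
  refine ⟨?_, hbdd, (hpos 1 one_pos).trans_le (le_csSup hbdd ⟨1, mem_Ioi.2 one_pos, rfl⟩)⟩
  refine continuousOn_critical_growth (h := h) (F := fun s ξ i => s ^ 2 * E1fun R₁ R₂ ρ ξ i.1 +
    Efun R₁ R₂ μ α g ρ s ξ i.1) hμ (fun i => (ha i).le) hb hc he hd hda
    (fun s ξ i => by rw [hE1, hE]; ring) hpos ?_ ?_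
  · intro ξ hξ i
    have hle : Phi R₁ R₂ μ α g ρ (lam0 ξ) ξ ≤ _ :=
      csInf_le ⟨-M, hlower _ ξ (hpos ξ hξ) hξ⟩ ⟨i.1, i.2.1, i.2.2, rfl⟩
    rw [hPhi ξ hξ, le_div_iff₀ (hE1pos ξ hξ i)] at hle
    linarith
  · intro ξ hξ s hs hsl
    have hΦ := hPhi ξ hξ
    have hsq : s ^ 2 < lam0 ξ ^ 2 := by gcongr
    have hlne : 0 < lam0 ξ ^ 2 := (by positivity : 0 ≤ s ^ 2).trans_lt hsq
    have hne : (PhiSet R₁ R₂ μ α g ρ (lam0 ξ) ξ).Nonempty := by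
      rw [nonempty_iff_ne_empty]
      intro hempty
      rw [Phi, hempty, Real.sInf_empty] at hΦ
      linarith
    rw [Phi] at hΦ
    obtain ⟨_, ⟨W, hW, hW0, rfl⟩, hlt⟩ :=
      exists_lt_of_csInf_lt hne (show sInf _ < -s ^ 2 by linarith)
    let i : ι := ⟨W, hW, hW0⟩
    refine ⟨i, ?_⟩
    rw [div_lt_iff₀ (hE1pos ξ hξ i)] at hlt
    have hmono : Efun R₁ R₂ μ α g ρ s ξ i.1 ≤ Efun R₁ R₂ μ α g ρ (lam0 ξ) ξ i.1 := by
      have := hc i; have := hd i; have := he i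
      rw [hE, hE]
      gcongr
    change s ^ 2 * E1fun R₁ R₂ ρ ξ W + Efun R₁ R₂ μ α g ρ s ξ W < 0
    have : Efun R₁ R₂ μ α g ρ s ξ W ≤ Efun R₁ R₂ μ α g ρ (lam0 ξ) ξ W := hmono
    linarith

end
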